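/- arXiv:1302.2737 — 2 statements merged into one kernel-verified Lean document; each statement's English description precedes it below -/
import Mathlib

section
/- Let C and D be cochain complexes over F₂ each equipped with a nice cup_i-structure, and let f : C → D be a morphism of cochain complexes that is multiplicative for all the cup_i-products, i.e. f(x ∪_i y) = f(x) ∪_i f(y) for all i ≥ 0 and all x, y ∈ C. Then for all integers p, q ≥ 0, every i ≥ 0, and all homogeneous elements α ∈ P_p(f) and β ∈ P_q(f), the element α ∪_i β belongs to P_{p+q}(f). -/
/-- A cochain complex over `𝔽₂` (with homogeneous components realized as
submodules `deg n` of an ambient module), equipped with a `cup_i`-structure: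
a family of bilinear maps `cup i : A^r × A^s → A^(r+s-i)` for `i ≥ 0`, with
the convention `cup i = 0` for `i < 0`, satisfying the Leibniz rule. -/
structure CupComplex (M : Type*) [AddCommGroup M] [Module (ZMod 2) M] where
  /-- homogeneous component of degree `n` -/
  deg : ℤ → Submodule (ZMod 2) M
  /-- the differential -/
  d : M →ₗ[ZMod 2] M
  /-- the family of `cup_i`-products -/
  cup : ℤ → M →ₗ[ZMod 2] M →ₗ[ZMod 2] M
  deg_neg : ∀ n : ℤ, n < 0 → deg n = ⊥
  d_mem : ∀ (n : ℤ) (x : M), x ∈ deg n → d x ∈ deg (n + 1)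
  d_squared : ∀ x : M, d (d x) = 0
  cup_neg : ∀ i : ℤ, i < 0 → cup i = 0
  cup_mem : ∀ (i r s : ℤ) (x y : M), x ∈ deg r → y ∈ deg s →
    cup i x y ∈ deg (r + s - i)
  leibniz : ∀ (i r s : ℤ) (x y : M), x ∈ deg r → y ∈ deg s →
    d (cup i x y) =
      cup (i - 1) x y + cup (i - 1) y x + cup i (d x) y + cup i x (d y)

/-- A `cup_i`-structure is *nice* if `x ∪_{|x|} x = x` for homogeneous `x`, and
`x ∪_i x' = 0` whenever `i > min (|x|, |x'|)` for homogeneous `x`, `x'`. -/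
def CupComplex.Nice {M : Type*} [AddCommGroup M] [Module (ZMod 2) M]
    (S : CupComplex M) : Prop :=
  (∀ (n : ℤ) (x : M), x ∈ S.deg n → S.cup n x x = x) ∧
  (∀ (i r s : ℤ) (x y : M), x ∈ S.deg r → y ∈ S.deg s → min r s < i →
    S.cup i x y = 0)

section Pcx

variable {M N : Type*} [AddCommGroup M] [Module (ZMod 2) M]
  [AddCommGroup N] [Module (ZMod 2) N]

/-- The graded subspace `P_r(f) ⊆ C` attached to a morphism `f : C → D` of
cochain complexes and `r ≥ 0`: `P_r(f)^k = C^k` for `k < r`,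
`P_r(f)^r = {α ∈ C^r : δ(fα) = 0}`, and `P_r(f)^k = {α ∈ C^k : fα = 0}`
for `k > r`. -/
def Pcx (SC : CupComplex M) (SD : CupComplex N) (f : M →ₗ[ZMod 2] N)
    (r k : ℤ) : Submodule (ZMod 2) M :=
  if k < r then SC.deg k
  else if k = r then SC.deg r ⊓ LinearMap.ker (SD.d ∘ₗ f)
  else SC.deg k ⊓ LinearMap.ker f

end Pcx

section Pcx

variable {M N : Type*} [AddCommGroup M] [Module (ZMod 2) M]
  [AddCommGroup N] [Module (ZMod 2) N]
  {SC : CupComplex M} {SD : CupComplex N} {f : M →ₗ[ZMod 2] N} {r k : ℤ} {x : M}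

theorem mem_Pcx_iff :
    x ∈ Pcx SC SD f r k ↔
      x ∈ SC.deg k ∧ (k = r → SD.d (f x) = 0) ∧ (r < k → f x = 0) := by
  unfold Pcx
  split_ifs with h₁ h₂
  · exact ⟨fun h => ⟨h, fun e => by lia, fun e => by lia⟩, And.left⟩
  · subst h₂
    simp
  · have h₃ : r < k := by lia
    simp [h₂, h₃]

end Pcx

/-- Let `f : C → D` be a morphism of cochain complexes over
`𝔽₂` carrying nice `cup_i`-structures, multiplicative for all the
`cup_i`-products. For `p, q ≥ 0`, `i ≥ 0` and homogeneous `α ∈ P_p(f)` (of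
degree `k`), `β ∈ P_q(f)` (of degree `l`), the element `α ∪_i β` (of degree
`k + l - i`) belongs to `P_{p+q}(f)`. -/
theorem cup_mem_P {M N : Type*}
    [AddCommGroup M] [Module (ZMod 2) M] [AddCommGroup N] [Module (ZMod 2) N]
    (SC : CupComplex M) (SD : CupComplex N)
    (hC : SC.Nice) (hD : SD.Nice)
    (f : M →ₗ[ZMod 2] N)
    (hfd : ∀ x : M, f (SC.d x) = SD.d (f x))
    (hfdeg : ∀ (k : ℤ) (x : M), x ∈ SC.deg k → f x ∈ SD.deg k)
    (hfcup : ∀ (i : ℤ) (x y : M), f (SC.cup i x y) = SD.cup i (f x) (f y))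
    (p q i k l : ℤ) (hp : 0 ≤ p) (hq : 0 ≤ q) (hi : 0 ≤ i)
    (α β : M) (hα : α ∈ Pcx SC SD f p k) (hβ : β ∈ Pcx SC SD f q l) :
    SC.cup i α β ∈ Pcx SC SD f (p + q) (k + l - i) := by
  rw [mem_Pcx_iff] at hα hβ ⊢
  obtain ⟨hαk, hαd, hα0⟩ := hα
  obtain ⟨hβl, hβd, hβ0⟩ := hβ
  refine ⟨SC.cup_mem i k l α β hαk hβl, fun hn => ?_, fun hn => ?_⟩
  · rw [hfcup]
    by_cases hk : p < k
    · simp [hα0 hk]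
    by_cases hl : q < l
    · simp [hβ0 hl]
    rw [SD.leibniz i k l _ _ (hfdeg k α hαk) (hfdeg l β hβl),
      SD.cup_neg (i - 1) (by lia), hαd (by lia), hβd (by lia)]
    simp
  · rw [hfcup]
    by_cases hk : p < k
    · simp [hα0 hk]
    · simp [hβ0 (by lia)]
end

section
/- Let C and D be cochain complexes over F₂ each equipped with a nice cup_i-structure, and let f : C → D be a morphism of cochain complexes that is multiplicative for all the cup_i-products, i.e. f(x ∪_i y) = f(x) ∪_i f(y) for all i ≥ 0 and all x, y ∈ C. Let p ≥ 0 and let α ∈ P_p(f) be a homogeneous cocycle of degree k, and let j ≥ 0 be an integer. Then the cochain-level Steenrod square Sq^j(α) = α ∪_{k−j} α is again a cocycle, and it belongs to P_{min(2p, p+j)}(f). (This is the Goresky–Pardon perversity bound min(2p̄, p̄ + j) for Sq^j in the algebraic model of a pseudomanifold with isolated singularities.) -/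
theorem CupComplex.d_cup_self_of_cocycle {M : Type*} [AddCommGroup M] [Module (ZMod 2) M]
    (S : CupComplex M) (i : ℤ) {n : ℤ} {x : M} (hx : x ∈ S.deg n) (hdx : S.d x = 0) :
    S.d (S.cup i x x) = 0 := by
  rw [S.leibniz i n n x x hx hx, hdx, map_zero, map_zero, LinearMap.zero_apply, add_zero,
    add_zero, ZModModule.add_self]

theorem Pcx_le_deg {M N : Type*} [AddCommGroup M] [Module (ZMod 2) M]
    [AddCommGroup N] [Module (ZMod 2) N] (SC : CupComplex M) (SD : CupComplex N)
    (f : M →ₗ[ZMod 2] N) (r k : ℤ) : Pcx SC SD f r k ≤ SC.deg k := by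
  unfold Pcx
  split_ifs with h₁ h₂
  · exact le_rfl
  · exact h₂ ▸ inf_le_left
  · exact inf_le_left

theorem mem_Pcx_of_cocycle {M N : Type*} [AddCommGroup M] [Module (ZMod 2) M]
    [AddCommGroup N] [Module (ZMod 2) N] (SC : CupComplex M) (SD : CupComplex N)
    (f : M →ₗ[ZMod 2] N) (hfd : ∀ x : M, f (SC.d x) = SD.d (f x)) {r k : ℤ} {x : M}
    (hx : x ∈ SC.deg k) (hdx : SC.d x = 0) (hfx : r < k → f x = 0) :
    x ∈ Pcx SC SD f r k := by
  unfold Pcx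
  split_ifs with h₁ h₂
  · exact hx
  · subst h₂
    exact ⟨hx, by simp [← hfd, hdx]⟩
  · exact ⟨hx, hfx (by omega)⟩

theorem map_eq_zero_of_mem_Pcx {M N : Type*} [AddCommGroup M] [Module (ZMod 2) M]
    [AddCommGroup N] [Module (ZMod 2) N] (SC : CupComplex M) (SD : CupComplex N)
    (f : M →ₗ[ZMod 2] N) {r k : ℤ} {x : M} (hx : x ∈ Pcx SC SD f r k) (hrk : r < k) :
    f x = 0 := by
  rw [Pcx, if_neg hrk.not_gt, if_neg hrk.ne'] at hx
  exact hx.2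

/-- (Goresky–Pardon bound, algebraic model with isolated
singularities.) Let `f : C → D` be a morphism of cochain complexes over `𝔽₂`
carrying nice `cup_i`-structures, multiplicative for all the `cup_i`-products.
If `p ≥ 0`, `j ≥ 0` and `α ∈ P_p(f)` is a homogeneous cocycle of degree `k`,
then `Sq^j(α) = α ∪_{k-j} α` is again a cocycle and belongs to
`P_{min(2p, p+j)}(f)` (in degree `k + j`). -/
theorem sq_mem_P_min {M N : Type*}
    [AddCommGroup M] [Module (ZMod 2) M] [AddCommGroup N] [Module (ZMod 2) N]
    (SC : CupComplex M) (SD : CupComplex N)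
    (hC : SC.Nice) (hD : SD.Nice)
    (f : M →ₗ[ZMod 2] N)
    (hfd : ∀ x : M, f (SC.d x) = SD.d (f x))
    (hfdeg : ∀ (k : ℤ) (x : M), x ∈ SC.deg k → f x ∈ SD.deg k)
    (hfcup : ∀ (i : ℤ) (x y : M), f (SC.cup i x y) = SD.cup i (f x) (f y))
    (p k j : ℤ) (hp : 0 ≤ p) (hj : 0 ≤ j)
    (α : M) (hα : α ∈ Pcx SC SD f p k) (hαcocycle : SC.d α = 0) :
    SC.d (SC.cup (k - j) α α) = 0 ∧
      SC.cup (k - j) α α ∈ Pcx SC SD f (min (2 * p) (p + j)) (k + j) := by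
  have hdeg : α ∈ SC.deg k := Pcx_le_deg SC SD f p k hα
  have hd := SC.d_cup_self_of_cocycle (k - j) hdeg hαcocycle
  have hmem := SC.cup_mem (k - j) k k α α hdeg hdeg
  rw [show k + k - (k - j) = k + j by ring] at hmem
  refine ⟨hd, mem_Pcx_of_cocycle SC SD f hfd hmem hd fun hlt => ?_⟩
  rcases lt_or_ge p k with hpk | hkp
  · rw [hfcup, map_eq_zero_of_mem_Pcx SC SD f hα hpk, map_zero]
  · rw [SC.cup_neg (k - j) (by omega), LinearMap.zero_apply, LinearMap.zero_apply, map_zero]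
end
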